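/- For continuous maps f₁, f₂ : K → K over S¹, the pair (f₁, f₂) is loose over S¹ if and only if f₂ is homotopic over S¹ to α ∘ f₁, where α : K → K is the fibrewise antipodal map induced by (t,z) ↦ (t, z + 1/2). (Looseness criterion of Theorem 1.3(ii): the pair is loose over S¹ exactly when it consists of two antipodal maps.) -/

import Mathlib

noncomputable section

abbrev Circle1 : Type := AddCircle (1 : ℝ)

/-- The relation on `ℝ × S¹` whose quotient is the Klein bottle:
`(t, z) ∼ (t + n, (-1)ⁿ • z)` for `n : ℤ`. -/
def kleinRel : (ℝ × Circle1) → (ℝ × Circle1) → Prop :=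
  fun a b => ∃ n : ℤ, b = (a.1 + n, (((-1 : ℤˣ) ^ n : ℤˣ) : ℤ) • a.2)

/-- The Klein bottle, as the quotient of `ℝ × S¹` by `kleinRel`. -/
abbrev KleinBottle : Type := Quot kleinRel

lemma coe_int_add (x : ℝ) (n : ℤ) : ((x + n : ℝ) : Circle1) = (x : Circle1) := by
  have h : ((n : ℝ) : Circle1) = 0 := by
    rw [AddCircle.coe_eq_zero_iff]; exact ⟨n, by simp⟩
  rw [QuotientAddGroup.mk_add, h, add_zero]

/-- The half point `1/2` of `S¹`, which is its own negative. -/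
def half : Circle1 := ((1/2 : ℝ) : Circle1)

lemma neg_half : -half = half := by
  rw [half, ← QuotientAddGroup.mk_neg]
  have : ((-(1/2) + 1 : ℝ) : Circle1) = ((-(1/2) : ℝ) : Circle1) := AddCircle.coe_add_period 1 _
  rw [← this]; norm_num

lemma units_smul_self_neg (u : ℤˣ) (z : Circle1) (hz : -z = z) : (u : ℤ) • z = z := by
  rcases Int.units_eq_one_or u with h | h <;> rw [h] <;> simp [hz]

/-- The projection `p_K : K → S¹` of the Klein bottle, induced by `(t, z) ↦ (t mod 1)`. -/
def pK : C(KleinBottle, Circle1) :=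
  ⟨Quot.lift (fun a => (a.1 : Circle1)) (by
      rintro a b ⟨n, rfl⟩
      exact (coe_int_add a.1 n).symm),
    continuous_quot_lift _ (continuous_coinduced_rng.comp continuous_fst)⟩

/-- A self map of the Klein bottle is a map over `S¹` if it commutes with `p_K`. -/
def KleinOverCircle (f : C(KleinBottle, KleinBottle)) : Prop := ∀ x, pK (f x) = pK x

/-- Two self-maps of `K` over `S¹` are homotopic over `S¹` if there is a homotopy between
them through maps over `S¹`. -/
def KleinHomotopicOver (f g : C(KleinBottle, KleinBottle)) : Prop :=
  ∃ H : ContinuousMap.Homotopy f g,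
    ∀ (s : unitInterval) (x : KleinBottle), pK (H (s, x)) = pK x

/-- The standard fibre-preserving self map `g_{q,r}` of the Klein bottle, induced by
`(t, z) ↦ (t, q • z + r • (1/2))`. -/
def kleinStdMap (q r : ℤ) : C(KleinBottle, KleinBottle) :=
  ⟨Quot.lift (fun a => Quot.mk kleinRel (a.1, q • a.2 + r • half))
    (by
      rintro a b ⟨n, rfl⟩
      apply Quot.sound
      refine ⟨n, ?_⟩
      simp only [Prod.mk.injEq, true_and]
      rw [smul_add, smul_comm ((((-1 : ℤˣ) ^ n : ℤˣ) : ℤ)) q,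
        units_smul_self_neg _ (r • half) (by rw [← smul_neg, neg_half])]),
    continuous_quot_lift _ ((continuous_quot_mk).comp (by fun_prop))⟩


/-- The fibrewise antipodal map `α : K → K`, induced by `(t, z) ↦ (t, z + 1/2)`. -/
def kleinAntipodal : C(KleinBottle, KleinBottle) :=
  ⟨Quot.lift (fun a => Quot.mk kleinRel (a.1, a.2 + half))
    (by
      rintro a b ⟨n, rfl⟩
      apply Quot.sound
      refine ⟨n, ?_⟩
      simp only [Prod.mk.injEq, true_and]
      rw [smul_add, units_smul_self_neg _ half neg_half]),
    continuous_quot_lift _ (continuous_quot_mk.comp (by fun_prop))⟩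

/-- A pair of maps over `S¹` is loose over `S¹` if the maps can be deformed over `S¹` to be
coincidence free. -/
def KleinLooseOverCircle (f₁ f₂ : C(KleinBottle, KleinBottle)) : Prop :=
  ∃ f₁' f₂' : C(KleinBottle, KleinBottle),
    KleinHomotopicOver f₁ f₁' ∧ KleinHomotopicOver f₂ f₂' ∧
    {x : KleinBottle | f₁' x = f₂' x} = ∅

open Set Filter Topology

lemma kleinRel_equivalence : Equivalence kleinRel where
  refl a := ⟨0, by simp⟩
  symm := by
    rintro a b ⟨n, rfl⟩
    refine ⟨-n, ?_⟩
    ext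
    · simp
    · simp only [smul_smul, ← Units.val_mul, ← zpow_add]
      simp
  trans := by
    rintro a b c ⟨n, rfl⟩ ⟨m, rfl⟩
    refine ⟨n + m, ?_⟩
    ext
    · simp [add_assoc]
    · simp only [smul_smul, ← Units.val_mul, ← zpow_add, add_comm n m]

lemma kleinBottle_mk_eq_iff {a b : ℝ × Circle1} :
    Quot.mk kleinRel a = Quot.mk kleinRel b ↔ kleinRel a b :=
  kleinRel_equivalence.quot_mk_eq_iff a b

lemma kleinBottle_mk_translate (n : ℤ) (a : ℝ × Circle1) :
    Quot.mk kleinRel (a.1 + n, (((-1 : ℤˣ) ^ n : ℤˣ) : ℤ) • a.2) = Quot.mk kleinRel a :=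
  (Quot.sound ⟨n, rfl⟩).symm

/-- The covering `ℝ × S¹ → K` is injective on each fibre over `ℝ`. -/
lemma kleinBottle_mk_fiber_injective {t : ℝ} {z w : Circle1}
    (h : Quot.mk kleinRel (t, z) = Quot.mk kleinRel (t, w)) : z = w := by
  obtain ⟨n, hn⟩ := kleinBottle_mk_eq_iff.1 h
  rw [Prod.mk.injEq] at hn
  obtain ⟨h1, h2⟩ := hn
  have h0 : n = 0 := by
    have : (n : ℝ) = 0 := by linarith
    exact_mod_cast this
  subst h0
  simpa using h2.symm

lemma isOpenQuotientMap_kleinBottle_mk : IsOpenQuotientMap (Quot.mk kleinRel) := by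
  refine ⟨Quot.mk_surjective, continuous_quot_mk, fun V hV => ?_⟩
  rw [← isQuotientMap_quot_mk.isOpen_preimage]
  have h : Quot.mk kleinRel ⁻¹' (Quot.mk kleinRel '' V) =
      ⋃ n : ℤ, (fun a : ℝ × Circle1 => (a.1 + (n : ℝ), (((-1 : ℤˣ) ^ n : ℤˣ) : ℤ) • a.2)) ⁻¹' V := by
    ext a
    simp only [mem_preimage, mem_image, mem_iUnion]
    constructor
    · rintro ⟨b, hb, hba⟩
      obtain ⟨n, rfl⟩ := kleinBottle_mk_eq_iff.1 hba.symm
      exact ⟨n, hb⟩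
    · rintro ⟨n, hn⟩
      exact ⟨_, hn, kleinBottle_mk_translate n a⟩
  rw [h]
  exact isOpen_iUnion fun n => hV.preimage (by fun_prop)

lemma pK_mk (a : ℝ × Circle1) : pK (Quot.mk kleinRel a) = (a.1 : Circle1) := rfl

/-- Points of `ℝ` with the same image in `S¹` differ by an integer. -/
lemma exists_int_of_circle_coe_eq {s t : ℝ} (h : (s : Circle1) = t) : ∃ n : ℤ, t = s + n := by
  obtain ⟨n, hn⟩ := AddCircle.coe_eq_zero_iff (1 : ℝ) |>.1
    (show ((t - s : ℝ) : Circle1) = 0 by rw [AddCircle.coe_sub, h, sub_self])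
  refine ⟨n, ?_⟩
  rw [zsmul_eq_mul, mul_one] at hn
  linarith

lemma exists_kleinBottle_mk_eq {k : KleinBottle} {t : ℝ} (h : pK k = (t : Circle1)) :
    ∃ z, k = Quot.mk kleinRel (t, z) := by
  obtain ⟨⟨s, z⟩, rfl⟩ := Quot.mk_surjective k
  obtain ⟨n, rfl⟩ := exists_int_of_circle_coe_eq h
  exact ⟨_, (kleinBottle_mk_translate n (s, z)).symm⟩

/-- A self map of `K` over `S¹` lifts to a map of `ℝ × S¹` over `ℝ`. -/
lemma KleinOverCircle.exists_lift {f : C(KleinBottle, KleinBottle)} (hf : KleinOverCircle f) :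
    ∃ F : C(ℝ × Circle1, Circle1),
      ∀ a, f (Quot.mk kleinRel a) = Quot.mk kleinRel (a.1, F a) := by
  choose F hF using fun a : ℝ × Circle1 =>
    exists_kleinBottle_mk_eq ((hf (Quot.mk kleinRel a)).trans (pK_mk a))
  refine ⟨⟨F, continuous_iff_continuousAt.2 fun a U hU => ?_⟩, hF⟩
  have hnhds : Metric.ball a.1 (1 / 4) ×ˢ U ∈ 𝓝 (a.1, F a) :=
    prod_mem_nhds (Metric.ball_mem_nhds _ (by norm_num)) hU
  have himage := isOpenQuotientMap_kleinBottle_mk.isOpenMap.image_mem_nhds hnhds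
  rw [← hF a] at himage
  have hcont : Continuous fun b : ℝ × Circle1 => f (Quot.mk kleinRel b) :=
    f.continuous.comp continuous_quot_mk
  change ∀ᶠ b in 𝓝 a, F b ∈ U
  filter_upwards [hcont.continuousAt himage,
    continuous_fst.continuousAt (Metric.ball_mem_nhds a.1 (by norm_num : (0 : ℝ) < 1 / 4))]
    with b hb hba
  obtain ⟨⟨t, w⟩, ⟨ht, hw⟩, hbt⟩ := hb
  have hbt' : Quot.mk kleinRel (t, w) = Quot.mk kleinRel (b.1, F b) := hbt.trans (hF b)
  obtain ⟨n, hn⟩ := kleinBottle_mk_eq_iff.1 hbt'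
  have hn1 : b.1 = t + n := congrArg Prod.fst hn
  simp only [Metric.mem_ball, Real.dist_eq, mem_preimage] at ht hba
  rw [abs_lt] at ht hba
  have h0 : n = 0 := by
    have hlt : (n : ℝ) < 1 := by linarith
    have hgt : (-1 : ℝ) < n := by linarith
    have : n < 1 := by exact_mod_cast hlt
    have : -1 < n := by exact_mod_cast hgt
    omega
  have htb : t = b.1 := by simp [hn1, h0]
  rw [htb] at hbt'
  rwa [← kleinBottle_mk_fiber_injective hbt']

lemma kleinLift_translate {f : C(KleinBottle, KleinBottle)} {F : C(ℝ × Circle1, Circle1)}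
    (hF : ∀ a, f (Quot.mk kleinRel a) = Quot.mk kleinRel (a.1, F a)) (n : ℤ) (a : ℝ × Circle1) :
    F (a.1 + n, (((-1 : ℤˣ) ^ n : ℤˣ) : ℤ) • a.2) = (((-1 : ℤˣ) ^ n : ℤˣ) : ℤ) • F a := by
  refine kleinBottle_mk_fiber_injective (t := a.1 + n) ?_
  rw [← hF (a.1 + n, (((-1 : ℤˣ) ^ n : ℤˣ) : ℤ) • a.2), kleinBottle_mk_translate, hF]
  exact (kleinBottle_mk_translate n (a.1, F a)).symm

/-- The signed distance from a point `u ≠ 0` of `S¹` to `1/2` along the arc avoiding `0`. -/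
def antipodalShift (u : Circle1) : ℝ := 1 / 2 - (AddCircle.equivIco 1 0 u : ℝ)

lemma continuousAt_antipodalShift {u : Circle1} (hu : u ≠ 0) : ContinuousAt antipodalShift u :=
  continuousAt_const.sub
    (continuous_subtype_val.continuousAt.comp (AddCircle.continuousAt_equivIco 1 0 hu))

lemma coe_antipodalShift (u : Circle1) : (antipodalShift u : Circle1) = half - u := by
  rw [antipodalShift, AddCircle.coe_sub, AddCircle.coe_equivIco, half]

lemma antipodalShift_neg {u : Circle1} (hu : u ≠ 0) : antipodalShift (-u) = -antipodalShift u := by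
  have hr := (AddCircle.equivIco 1 0 u).2
  have hru : ((AddCircle.equivIco 1 0 u : ℝ) : Circle1) = u := AddCircle.coe_equivIco
  unfold antipodalShift
  generalize (AddCircle.equivIco 1 0 u : ℝ) = r at hr hru
  have hr0 : r ≠ 0 := by
    rintro rfl
    exact hu (hru.symm.trans (by simp))
  have hpos : 0 < r := lt_of_le_of_ne hr.1 hr0.symm
  have hneg : -u = ((1 - r : ℝ) : Circle1) := by
    rw [AddCircle.coe_sub, hru, AddCircle.coe_period, zero_sub]
  rw [hneg, AddCircle.equivIco_coe_eq ⟨by linarith [hr.2], by linarith⟩]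
  ring

lemma antipodalShift_units_smul (e : ℤˣ) {u : Circle1} (hu : u ≠ 0) :
    antipodalShift ((e : ℤ) • u) = (e : ℤ) • antipodalShift u := by
  rcases Int.units_eq_one_or e with rfl | rfl
  · simp
  · simpa using antipodalShift_neg hu

lemma kleinHomotopicOver_iff {f g : C(KleinBottle, KleinBottle)} :
    KleinHomotopicOver f g ↔ ContinuousMap.HomotopicWith f g KleinOverCircle :=
  ⟨fun ⟨H, hH⟩ => ⟨⟨H, fun s x => hH s x⟩⟩, fun ⟨H⟩ => ⟨H.toHomotopy, fun s x => H.prop' s x⟩⟩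

lemma KleinHomotopicOver.symm {f g : C(KleinBottle, KleinBottle)} (h : KleinHomotopicOver f g) :
    KleinHomotopicOver g f :=
  kleinHomotopicOver_iff.2 (kleinHomotopicOver_iff.1 h).symm

lemma KleinHomotopicOver.trans {f g k : C(KleinBottle, KleinBottle)}
    (h : KleinHomotopicOver f g) (h' : KleinHomotopicOver g k) : KleinHomotopicOver f k :=
  kleinHomotopicOver_iff.2 ((kleinHomotopicOver_iff.1 h).trans (kleinHomotopicOver_iff.1 h'))

lemma KleinHomotopicOver.kleinOverCircle_right {f g : C(KleinBottle, KleinBottle)}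
    (h : KleinHomotopicOver f g) : KleinOverCircle g := fun x => by
  obtain ⟨H, hH⟩ := h
  simpa using hH 1 x

lemma KleinOverCircle.refl {f : C(KleinBottle, KleinBottle)} (hf : KleinOverCircle f) :
    KleinHomotopicOver f f :=
  kleinHomotopicOver_iff.2 (.refl f hf)

lemma kleinAntipodal_mk (a : ℝ × Circle1) :
    kleinAntipodal (Quot.mk kleinRel a) = Quot.mk kleinRel (a.1, a.2 + half) := rfl

lemma pK_kleinAntipodal (x : KleinBottle) : pK (kleinAntipodal x) = pK x := by
  obtain ⟨a, rfl⟩ := Quot.mk_surjective x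
  rfl

lemma half_ne_zero : half ≠ 0 := by
  rw [half, Ne, AddCircle.coe_eq_zero_iff_of_mem_Ico ⟨by norm_num, by norm_num⟩]
  norm_num

lemma kleinAntipodal_ne (x : KleinBottle) : x ≠ kleinAntipodal x := by
  obtain ⟨⟨t, z⟩, rfl⟩ := Quot.mk_surjective x
  intro h
  exact half_ne_zero (left_eq_add.1 (kleinBottle_mk_fiber_injective h))

lemma KleinHomotopicOver.kleinAntipodal_comp {f g : C(KleinBottle, KleinBottle)}
    (h : KleinHomotopicOver f g) :
    KleinHomotopicOver (kleinAntipodal.comp f) (kleinAntipodal.comp g) := by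
  obtain ⟨H, hH⟩ := h
  exact ⟨(ContinuousMap.Homotopy.refl kleinAntipodal).comp H,
    fun s x => (pK_kleinAntipodal _).trans (hH s x)⟩

/-- Coincidence free maps over `S¹` are antipodal: slide `g x` to the antipode of `f x` along the
arc of the fibre circle avoiding `f x`. -/
lemma kleinHomotopicOver_antipodal_of_forall_ne {f g : C(KleinBottle, KleinBottle)}
    (hf : KleinOverCircle f) (hg : KleinOverCircle g) (hfg : ∀ x, f x ≠ g x) :
    KleinHomotopicOver g (kleinAntipodal.comp f) := by
  obtain ⟨F, hF⟩ := hf.exists_lift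
  obtain ⟨G, hG⟩ := hg.exists_lift
  have hne (a) : G a - F a ≠ 0 := fun h => hfg (Quot.mk kleinRel a) <| by
    rw [hF, hG, sub_eq_zero.1 h]
  have hshift : Continuous fun a => antipodalShift (G a - F a) :=
    continuous_iff_continuousAt.2 fun a =>
      (continuousAt_antipodalShift (hne a)).comp
        (f := fun a => G a - F a) (by fun_prop)
  let Φ : unitInterval × (ℝ × Circle1) → KleinBottle := fun p =>
    Quot.mk kleinRel (p.2.1,
      G p.2 + (((p.1 : ℝ) * antipodalShift (G p.2 - F p.2) : ℝ) : Circle1))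
  have hΦ : Continuous Φ := by
    refine continuous_quot_mk.comp ?_
    refine (by fun_prop : Continuous fun p : unitInterval × (ℝ × Circle1) => p.2.1).prodMk ?_
    refine (by fun_prop : Continuous fun p : unitInterval × (ℝ × Circle1) => G p.2).add ?_
    refine (AddCircle.continuous_mk' 1).comp ?_
    exact (continuous_subtype_val.comp continuous_fst).mul (hshift.comp continuous_snd)
  have hrel (s : unitInterval) (a b : ℝ × Circle1) (hab : kleinRel a b) :
      Φ (s, a) = Φ (s, b) := by
    obtain ⟨n, rfl⟩ := hab
    refine Quot.sound ⟨n, ?_⟩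
    ext
    · rfl
    · simp only [kleinLift_translate hF, kleinLift_translate hG, ← smul_sub,
        antipodalShift_units_smul _ (hne a), smul_add, mul_smul_comm, AddCircle.coe_zsmul]
  let H : unitInterval × KleinBottle → KleinBottle := fun p =>
    Quot.lift (fun a => Φ (p.1, a)) (hrel p.1) p.2
  have hH : Continuous H :=
    (IsOpenQuotientMap.id.prodMap isOpenQuotientMap_kleinBottle_mk).isQuotientMap.continuous_iff.2
      hΦ
  refine ⟨⟨⟨H, hH⟩, fun x => ?_, fun x => ?_⟩, fun s x => ?_⟩
  · obtain ⟨a, rfl⟩ := Quot.mk_surjective x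
    change Φ (0, a) = _
    simp [Φ, hG]
  · obtain ⟨a, rfl⟩ := Quot.mk_surjective x
    change Φ (1, a) = _
    simp only [Φ, Set.Icc.coe_one, one_mul, coe_antipodalShift, ContinuousMap.comp_apply, hF,
      kleinAntipodal_mk]
    congr 2
    abel
  · obtain ⟨a, rfl⟩ := Quot.mk_surjective x
    rfl

/-- Looseness criterion of Theorem 1.3(ii): a pair of self-maps of the Klein bottle over `S¹`
is loose over `S¹` if and only if it consists of two antipodal maps, i.e. `f₂` is homotopic
over `S¹` to `α ∘ f₁`. -/
theorem klein_loose_iff_antipodal (f₁ f₂ : C(KleinBottle, KleinBottle))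
    (h₁ : KleinOverCircle f₁) (h₂ : KleinOverCircle f₂) :
    KleinLooseOverCircle f₁ f₂ ↔ KleinHomotopicOver f₂ (kleinAntipodal.comp f₁) := by
  constructor
  · rintro ⟨g₁, g₂, hg₁, hg₂, hempty⟩
    have hne (x) : g₁ x ≠ g₂ x := fun h => (eq_empty_iff_forall_notMem.1 hempty) x h
    exact (hg₂.trans (kleinHomotopicOver_antipodal_of_forall_ne hg₁.kleinOverCircle_right
      hg₂.kleinOverCircle_right hne)).trans hg₁.symm.kleinAntipodal_comp
  · intro h
    exact ⟨f₁, kleinAntipodal.comp f₁, h₁.refl, h,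
      eq_empty_iff_forall_notMem.2 fun x hx => kleinAntipodal_ne (f₁ x) hx⟩
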